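/- arXiv:2008.12026 — 2 statements merged into one kernel-verified Lean document; each statement's English description precedes it below -/
import Mathlib

section
/- For any equivolume measurable partition Ω = (Ω_1,...,Ω_N) of [0,1]^d with N ≥ 2 sets and any p > 1, the stratified sample P_Ω satisfies E L_p(P_Ω)^p < E L_p(P_N)^p, where P_N is a set of N i.i.d. uniform random points in [0,1]^d (Strong Partition Principle). -/
open MeasureTheory Set
open scoped ENNReal

/-- The half-open box `[0,x) = ∏_j [0, x_j)`. -/
def box (d : ℕ) (x : Fin d → ℝ) : Set (Fin d → ℝ) :=
  Set.univ.pi fun j => Set.Ico 0 (x j)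

/-- The `p`-th power of the `L_p`-discrepancy of the point set `P` in `[0,1]^d`. -/
noncomputable def discP (d N : ℕ) (p : ℝ) (P : Fin N → Fin d → ℝ) : ℝ :=
  ∫ x in Set.Icc (0 : Fin d → ℝ) 1,
    |(Set.ncard {i | P i ∈ box d x} : ℝ) / N - (volume (box d x)).toReal| ^ p

/-- The uniform probability measure on a set `Ω` (normalized Lebesgue measure). -/
noncomputable def unif {d : ℕ} (Ω : Set (Fin d → ℝ)) : Measure (Fin d → ℝ) :=
  (volume Ω)⁻¹ • volume.restrict Ω

section HoeffdingInequality

variable {ι : Type*} [DecidableEq ι]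

/-- The expectation of `f S`, where `S` is the number of successes among independent trials
indexed by `T` with success probabilities `q`. -/
noncomputable def poissonBinomialMean (T : Finset ι) (q : ι → ℝ) (f : ℕ → ℝ) : ℝ :=
  ∑ s ∈ T.powerset, (∏ i ∈ T, if i ∈ s then q i else 1 - q i) * f s.card

theorem poissonBinomialMean_insert {T : Finset ι} {i : ι} (hi : i ∉ T) (q : ι → ℝ) (f : ℕ → ℝ) :
    poissonBinomialMean (insert i T) q f =
      (1 - q i) * poissonBinomialMean T q f
        + q i * poissonBinomialMean T q fun k => f (k + 1) := by
  unfold poissonBinomialMean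
  rw [Finset.sum_powerset_insert hi, Finset.mul_sum, Finset.mul_sum]
  congr 1
  · refine Finset.sum_congr rfl fun s hs => ?_
    have his : i ∉ s := fun h => hi (Finset.mem_powerset.1 hs h)
    rw [Finset.prod_insert hi, if_neg his, mul_assoc]
  · refine Finset.sum_congr rfl fun s hs => ?_
    have his : i ∉ s := fun h => hi (Finset.mem_powerset.1 hs h)
    rw [Finset.prod_insert hi, if_pos (Finset.mem_insert_self i s),
      Finset.card_insert_of_notMem his, mul_assoc]
    congr 2
    refine Finset.prod_congr rfl fun j hj => ?_
    have hji : j ≠ i := fun h => hi (h ▸ hj)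
    simp [Finset.mem_insert, hji]

theorem poissonBinomialMean_congr {T : Finset ι} {q r : ι → ℝ} (h : ∀ i ∈ T, q i = r i)
    (f : ℕ → ℝ) : poissonBinomialMean T q f = poissonBinomialMean T r f := by
  refine Finset.sum_congr rfl fun s _ => ?_
  congr 1
  exact Finset.prod_congr rfl fun i hi => by rw [h i hi]

theorem poissonBinomialMean_pos (T : Finset ι) {q : ι → ℝ} (hq0 : ∀ i, 0 ≤ q i)
    (hq1 : ∀ i, q i ≤ 1) {f : ℕ → ℝ} (hf : ∀ k, 0 < f k) : 0 < poissonBinomialMean T q f := by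
  induction T using Finset.induction_on generalizing f with
  | empty => simpa [poissonBinomialMean] using hf 0
  | insert i T hi ih =>
    rw [poissonBinomialMean_insert hi]
    have h1 := ih hf
    have h2 := ih fun k => hf (k + 1)
    rcases (hq0 i).eq_or_lt with h | h
    · simpa [← h] using h1
    · have := mul_nonneg (sub_nonneg.2 (hq1 i)) h1.le
      have := mul_pos h h2
      linarith

theorem poissonBinomialMean_second_difference (T : Finset ι) (q : ι → ℝ) (f : ℕ → ℝ) :
    poissonBinomialMean T q (fun k => f (k + 2) - 2 * f (k + 1) + f k) =
      poissonBinomialMean T q (fun k => f (k + 2))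
        - 2 * poissonBinomialMean T q (fun k => f (k + 1)) + poissonBinomialMean T q f := by
  simp only [poissonBinomialMean, Finset.mul_sum, ← Finset.sum_sub_distrib,
    ← Finset.sum_add_distrib]
  exact Finset.sum_congr rfl fun s _ => by ring

variable [Fintype ι]

/-- Moving two success probabilities closer together while keeping their sum increases
the expectation of a strictly convex function. -/
theorem poissonBinomialMean_lt_of_transfer {q r : ι → ℝ} (hq0 : ∀ i, 0 ≤ q i)
    (hq1 : ∀ i, q i ≤ 1) {f : ℕ → ℝ} (hf : ∀ k, 0 < f (k + 2) - 2 * f (k + 1) + f k)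
    {i j : ι} (hij : i ≠ j) (hr : ∀ k, k ≠ i → k ≠ j → q k = r k)
    (hsum : q i + q j = r i + r j) (hprod : q i * q j < r i * r j) :
    poissonBinomialMean Finset.univ q f < poissonBinomialMean Finset.univ r f := by
  set T : Finset ι := (Finset.univ.erase i).erase j with hT
  have hjT : j ∉ T := by simp [hT]
  have hiT : i ∉ insert j T := by simp [hT, hij]
  have huniv : Finset.univ = insert i (insert j T) := by
    rw [hT, Finset.insert_erase (by simp [hij.symm]), Finset.insert_erase (by simp)]
  have hcongr : ∀ k ∈ T, q k = r k := fun k hk => by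
    simp only [hT, Finset.mem_erase] at hk
    exact hr k hk.2.1 hk.1
  have hpos := poissonBinomialMean_pos T hq0 hq1 hf
  rw [poissonBinomialMean_second_difference] at hpos
  rw [huniv]
  simp only [poissonBinomialMean_insert hiT, poissonBinomialMean_insert hjT,
    ← poissonBinomialMean_congr hcongr]
  have := mul_pos (sub_pos.2 hprod) hpos
  have hrj : r j = q i + q j - r i := by linarith
  rw [hrj] at this ⊢
  linarith

/-- Hoeffding's comparison of Poisson-binomial distributions with the binomial distribution
of the same mean, for strictly convex functions. -/
theorem poissonBinomialMean_lt_binomial {q : ι → ℝ} (hq0 : ∀ i, 0 ≤ q i)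
    (hq1 : ∀ i, q i ≤ 1) {f : ℕ → ℝ} (hf : ∀ k, 0 < f (k + 2) - 2 * f (k + 1) + f k) {m : ℝ}
    (hsum : ∑ i, q i = ∑ _i : ι, m) (hne : ∃ i, q i ≠ m) :
    poissonBinomialMean Finset.univ q f < poissonBinomialMean Finset.univ (fun _ : ι => m) f := by
  induction hn : (Finset.univ.filter fun i => q i ≠ m).card using Nat.strong_induction_on
    generalizing q with
  | _ n ih =>
  obtain ⟨i, hi⟩ : ∃ i, q i < m := by
    by_contra! h
    obtain ⟨k, hk⟩ := hne
    exact hsum.not_gt (Finset.sum_lt_sum (fun i _ => h i) ⟨k, Finset.mem_univ k, (h k).lt_of_ne' hk⟩)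
  obtain ⟨j, hj⟩ : ∃ j, m < q j := by
    by_contra! h
    exact hsum.not_lt (Finset.sum_lt_sum (fun i _ => h i) ⟨i, Finset.mem_univ i, hi⟩)
  have hij : i ≠ j := by rintro rfl; exact lt_asymm hi hj
  set r : ι → ℝ := Function.update (Function.update q i m) j (q i + q j - m) with hr
  have hri : r i = m := by simp [hr, hij]
  have hrj : r j = q i + q j - m := by simp [hr]
  have hrk : ∀ k, k ≠ i → k ≠ j → q k = r k := fun k h1 h2 => by simp [hr, h1, h2]
  have hlt : poissonBinomialMean Finset.univ q f < poissonBinomialMean Finset.univ r f := by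
    refine poissonBinomialMean_lt_of_transfer hq0 hq1 hf hij hrk (by rw [hri, hrj]; ring) ?_
    rw [hri, hrj]
    nlinarith [mul_pos (sub_pos.2 hi) (sub_pos.2 hj)]
  have hmem : ∀ k, 0 ≤ r k ∧ r k ≤ 1 := fun k => by
    by_cases h2 : k = j
    · subst h2
      rw [hrj]
      constructor <;> linarith [hq0 i, hq1 k]
    by_cases h1 : k = i
    · subst h1
      rw [hri]
      constructor <;> linarith [hq0 k, hq1 j]
    rw [← hrk k h1 h2]
    exact ⟨hq0 k, hq1 k⟩
  have hrsum : ∑ k, r k = ∑ k, q k := by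
    have hsplit : ∀ u : ι → ℝ, ∑ k, u k = u i + (u j + ∑ k ∈ (Finset.univ.erase i).erase j, u k) :=
      fun u => by
        rw [Finset.add_sum_erase _ _ (by simp [hij.symm]), Finset.add_sum_erase _ _ (by simp)]
    rw [hsplit r, hsplit q, hri, hrj, Finset.sum_congr rfl fun k hk => by
      simp only [Finset.mem_erase] at hk
      exact (hrk k hk.2.1 hk.1).symm]
    ring
  by_cases hrne : ∃ k, r k ≠ m
  · refine hlt.trans (ih _ ?_ (fun k => (hmem k).1) (fun k => (hmem k).2) (hrsum.trans hsum)
      hrne rfl)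
    rw [← hn]
    refine Finset.card_lt_card (Finset.ssubset_iff_of_subset ?_ |>.2 ⟨i, ?_, ?_⟩)
    · intro k hk
      simp only [Finset.mem_filter, Finset.mem_univ, true_and] at hk ⊢
      by_cases h2 : k = j
      · exact h2 ▸ hj.ne'
      by_cases h1 : k = i
      · exact h1 ▸ hi.ne
      rwa [hrk k h1 h2]
    · simpa using hi.ne
    · simpa using hri
  · push Not at hrne
    rwa [show r = fun _ => m from funext hrne] at hlt

end HoeffdingInequality

theorem abs_rpow_second_difference_pos {p : ℝ} (hp : 1 < p) (a : ℝ) {h : ℝ} (hh : 0 < h) :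
    0 < |a + 2 * h| ^ p - 2 * |a + h| ^ p + |a| ^ p := by
  have hp0 : 0 < p := by linarith
  have hmid : |a + h| ≤ (|a + 2 * h| + |a|) / 2 := by
    have := abs_add_le (a + 2 * h) a
    rw [show a + 2 * h + a = 2 * (a + h) by ring, abs_mul, abs_two] at this
    linarith
  have hle := Real.rpow_le_rpow (abs_nonneg _) hmid hp0.le
  by_cases heq : |a + 2 * h| = |a|
  · have ha : a + h = 0 := by
      rcases abs_eq_abs.1 heq with h1 | h1 <;> linarith
    have : 0 < |a| ^ p := Real.rpow_pos_of_pos (abs_pos.2 (by linarith)) p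
    rw [ha, heq, abs_zero, Real.zero_rpow hp0.ne']
    linarith
  · have := (strictConvexOn_rpow hp).2 (abs_nonneg (a + 2 * h)) (abs_nonneg a) heq
      (show (0 : ℝ) < 1 / 2 by norm_num) (show (0 : ℝ) < 1 / 2 by norm_num) (by norm_num)
    simp only [smul_eq_mul] at this
    rw [show 1 / 2 * |a + 2 * h| + 1 / 2 * |a| = (|a + 2 * h| + |a|) / 2 by ring] at this
    linarith

theorem integral_pi_ncard {ι α : Type*} [Fintype ι] [DecidableEq ι] [MeasurableSpace α]
    (ν : ι → Measure α) [∀ i, IsProbabilityMeasure (ν i)] {B : Set α} (hB : MeasurableSet B)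
    (f : ℕ → ℝ) :
    ∫ P, f (Set.ncard {i | P i ∈ B}) ∂(Measure.pi ν) =
      poissonBinomialMean Finset.univ (fun i => (ν i).real B) f := by
  classical
  set A : Finset ι → Set (ι → α) := fun s => Set.univ.pi fun i => if i ∈ s then B else Bᶜ with hA
  have hAmeas : ∀ s, MeasurableSet (A s) := fun s =>
    MeasurableSet.univ_pi fun i => by split_ifs; exacts [hB, hB.compl]
  have hmem : ∀ (P : ι → α) s, P ∈ A s ↔ Finset.univ.filter (fun i => P i ∈ B) = s := by
    intro P s
    simp only [hA, Set.mem_univ_pi, Finset.ext_iff, Finset.mem_filter, Finset.mem_univ, true_and]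
    refine forall_congr' fun i => ?_
    by_cases hi : i ∈ s <;> simp [hi]
  have hsum : ∀ P : ι → α, f (Set.ncard {i | P i ∈ B}) =
      ∑ s : Finset ι, (A s).indicator (fun _ => f s.card) P := by
    intro P
    simp only [Set.indicator_apply, hmem, Finset.sum_ite_eq, Finset.mem_univ, if_true]
    congr 1
    rw [← Set.ncard_coe_finset]
    simp
  simp only [hsum]
  rw [integral_finsetSum _ fun s _ => (integrable_const _).indicator (hAmeas s),
    poissonBinomialMean, Finset.powerset_univ]
  refine Finset.sum_congr rfl fun s _ => ?_
  rw [integral_indicator_const _ (hAmeas s), smul_eq_mul, measureReal_def, hA, Measure.pi_pi,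
    ENNReal.toReal_prod]
  congr 1
  refine Finset.prod_congr rfl fun i _ => ?_
  split_ifs
  · rfl
  · rw [← measureReal_def, probReal_compl_eq_one_sub hB]

section Box

variable {d : ℕ}

theorem measurableSet_box (x : Fin d → ℝ) : MeasurableSet (box d x) :=
  MeasurableSet.univ_pi fun _ => measurableSet_Ico

theorem measurableSet_setOf_mem_box :
    MeasurableSet {z : (Fin d → ℝ) × (Fin d → ℝ) | z.1 ∈ box d z.2} := by
  simp only [box, Set.mem_univ_pi, Set.mem_Ico, Set.ofPred_forall]
  refine MeasurableSet.iInter fun j => ?_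
  have h1 : Measurable fun z : (Fin d → ℝ) × (Fin d → ℝ) => z.1 j := by fun_prop
  have h2 : Measurable fun z : (Fin d → ℝ) × (Fin d → ℝ) => z.2 j := by fun_prop
  exact (measurableSet_le measurable_const h1).inter (measurableSet_lt h1 h2)

theorem box_subset_Icc {x : Fin d → ℝ} (hx : x ∈ Set.Icc (0 : Fin d → ℝ) 1) :
    box d x ⊆ Set.Icc 0 1 := fun _ hz =>
  ⟨fun j => (hz j (Set.mem_univ j)).1,
    fun j => (hz j (Set.mem_univ j)).2.le.trans (hx.2 j)⟩

theorem volume_Icc_zero_one : volume (Set.Icc (0 : Fin d → ℝ) 1) = 1 := by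
  simp [Real.volume_Icc_pi]

instance isProbabilityMeasure_restrict_Icc_zero_one :
    IsProbabilityMeasure ((volume : Measure (Fin d → ℝ)).restrict (Set.Icc 0 1)) :=
  ⟨by rw [Measure.restrict_apply_univ, volume_Icc_zero_one]⟩

theorem ae_forall_ne_of_absolutelyContinuous {ν : Measure (Fin d → ℝ)} (hν : ν ≪ volume)
    (x : Fin d → ℝ) : ∀ᵐ z ∂ν, ∀ j, z j ≠ x j := by
  refine hν.ae_le (ae_all_iff.2 fun j => ?_)
  exact (Measure.tendsto_eval_ae_ae (μ := fun _ : Fin d => (volume : Measure ℝ)) (i := j)).eventually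
    (compl_mem_ae_iff.2 (measure_singleton (x j)))

theorem continuous_measure_box (ν : Measure (Fin d → ℝ)) [IsFiniteMeasure ν] (hν : ν ≪ volume) :
    Continuous fun x => ν (box d x) := by
  refine continuous_iff_continuousAt.2 fun x => ?_
  refine tendsto_measure_of_ae_tendsto_indicator_of_isFiniteMeasure _ (measurableSet_box x)
    measurableSet_box ?_
  filter_upwards [ae_forall_ne_of_absolutelyContinuous hν x] with z hz
  have : ∀ᶠ y in nhds x, ∀ j, z j < y j ↔ z j < x j := by
    refine Filter.eventually_all.2 fun j => ?_
    have hj : Filter.Tendsto (fun y : Fin d → ℝ => y j) (nhds x) (nhds (x j)) :=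
      (continuous_apply j).tendsto x
    rcases (hz j).lt_or_gt with h | h
    · filter_upwards [hj.eventually (lt_mem_nhds h)] with y hy
      simp [h, hy]
    · filter_upwards [hj.eventually (gt_mem_nhds h)] with y hy
      simp [h.not_gt, hy.not_gt]
  filter_upwards [this] with y hy
  simp [box, hy]

/-- A measure on the unit cube with a density is determined by its values on almost all boxes
anchored at the origin. -/
theorem eq_restrict_Icc_of_ae_measure_box_eq {ν : Measure (Fin d → ℝ)} [IsFiniteMeasure ν]
    (hν : ν ≪ volume) (hsupp : ∀ᵐ z ∂ν, z ∈ Set.Icc (0 : Fin d → ℝ) 1)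
    (h : ∀ᵐ x ∂(volume.restrict (Set.Icc (0 : Fin d → ℝ) 1)),
      ν (box d x) = volume (box d x)) :
    ν = volume.restrict (Set.Icc (0 : Fin d → ℝ) 1) := by
  set μ : Measure (Fin d → ℝ) := volume.restrict (Set.Icc (0 : Fin d → ℝ) 1) with hμ
  have hμac : μ ≪ volume := Measure.restrict_le_self.absolutelyContinuous
  have hIcc : Set.Icc (0 : Fin d → ℝ) 1 = Set.univ.pi fun _ => Set.Icc (0 : ℝ) 1 :=
    (Set.pi_univ_Icc _ _).symm
  have hbox : Set.EqOn (fun x => ν (box d x)) (fun x => μ (box d x)) (Set.Icc 0 1) := by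
    refine Measure.eqOn_of_ae_eq (μ := volume) ?_ (continuous_measure_box ν hν).continuousOn
      (continuous_measure_box μ hμac).continuousOn ?_
    · filter_upwards [h, ae_restrict_mem measurableSet_Icc] with x hx hxI
      simp only [hx, hμ]
      rw [Measure.restrict_eq_self _ (box_subset_Icc hxI)]
    · rw [hIcc, interior_pi_set Set.finite_univ, closure_pi_set]
      simp
  have hIio : ∀ (κ : Measure (Fin d → ℝ)), κ ≪ volume → (∀ᵐ z ∂κ, z ∈ Set.Icc (0 : Fin d → ℝ) 1) →
      ∀ a : Fin d → ℝ, κ (Set.univ.pi fun j => Set.Iio (a j)) = κ (box d (0 ⊔ (a ⊓ 1))) := by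
    intro κ hκ hκs a
    refine measure_congr ?_
    filter_upwards [ae_forall_ne_of_absolutelyContinuous hκ 1, hκs] with z hz hzI
    refine propext ?_
    change (z ∈ Set.univ.pi fun j => Set.Iio (a j)) ↔ z ∈ box d (0 ⊔ (a ⊓ 1))
    simp only [box, Set.mem_univ_pi, Set.mem_Iio, Set.mem_Ico]
    refine forall_congr' fun j => ?_
    have h0 : 0 ≤ z j := hzI.1 j
    have h1 : z j < 1 := (hzI.2 j).lt_of_ne (hz j)
    simp [h0, h0.not_gt, h1]
  have hpi : μ = Measure.pi fun _ => (volume : Measure ℝ).restrict (Set.Icc 0 1) := by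
    rw [hμ, hIcc, volume_pi, Measure.restrict_pi_pi]
  rw [hpi]
  symm
  refine Measure.pi_eq_generateFrom (C := fun _ => Set.range Set.Iio)
    (fun _ => (borel_eq_generateFrom_Iio ℝ).symm.trans BorelSpace.measurable_eq.symm)
    (fun _ => isPiSystem_Iio) (fun _ => ⟨fun n => Set.Iio (n : ℝ), fun n => ⟨_, rfl⟩,
      fun n => measure_lt_top _ _, Set.eq_univ_of_forall fun z => Set.mem_iUnion.2 ?_⟩) ?_
  · exact exists_nat_gt z
  · intro s hs
    choose a ha using hs
    obtain rfl : (fun j => Set.Iio (a j)) = s := funext ha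
    rw [← Measure.pi_pi, ← hpi, hIio ν hν hsupp, hIio μ hμac (ae_restrict_mem measurableSet_Icc)]
    exact hbox ⟨le_sup_left, sup_le zero_le_one inf_le_right⟩

end Box

section Discrepancy

variable {d N : ℕ} {p : ℝ}

theorem measurable_volume_box :
    Measurable fun x : Fin d → ℝ => (volume (box d x)).toReal := by
  simp only [box, volume_pi_pi, Real.volume_Ico]
  fun_prop

theorem measurable_ncard_mem_box {ι : Type*} [Fintype ι] :
    Measurable fun z : (ι → Fin d → ℝ) × (Fin d → ℝ) =>
      (Set.ncard {i | z.1 i ∈ box d z.2} : ℝ) := by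
  classical
  have hcard : ∀ z : (ι → Fin d → ℝ) × (Fin d → ℝ), (Set.ncard {i | z.1 i ∈ box d z.2} : ℝ) =
      ∑ i, if z.1 i ∈ box d z.2 then 1 else 0 := fun z => by
    rw [Finset.sum_boole, ← Set.ncard_coe_finset]
    simp
  simp only [hcard]
  refine Finset.measurable_sum _ fun i _ => Measurable.ite ?_ measurable_const measurable_const
  have hi : Measurable fun z : (ι → Fin d → ℝ) × (Fin d → ℝ) => (z.1 i, z.2) := by fun_prop
  exact hi measurableSet_setOf_mem_box

theorem integrable_local_discrepancy (hp : 0 ≤ p) (π : Measure (Fin N → Fin d → ℝ))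
    [IsProbabilityMeasure π] :
    Integrable (fun z : (Fin N → Fin d → ℝ) × (Fin d → ℝ) =>
      |(Set.ncard {i | z.1 i ∈ box d z.2} : ℝ) / N - (volume (box d z.2)).toReal| ^ p)
      (π.prod (volume.restrict (Set.Icc (0 : Fin d → ℝ) 1))) := by
  have hmeas : Measurable fun z : (Fin N → Fin d → ℝ) × (Fin d → ℝ) =>
      |(Set.ncard {i | z.1 i ∈ box d z.2} : ℝ) / N - (volume (box d z.2)).toReal| ^ p :=
    ((measurable_ncard_mem_box.div_const _).sub
      (measurable_volume_box.comp measurable_snd)).abs.pow_const p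
  refine Integrable.of_bound hmeas.aestronglyMeasurable 1 ?_
  have hIcc : ∀ᵐ z ∂(π.prod (volume.restrict (Set.Icc (0 : Fin d → ℝ) 1))),
      z.2 ∈ Set.Icc (0 : Fin d → ℝ) 1 :=
    Measure.quasiMeasurePreserving_snd.ae (ae_restrict_mem measurableSet_Icc)
  filter_upwards [hIcc] with z hz
  have hvol : (volume (box d z.2)).toReal ≤ 1 := by
    refine ENNReal.toReal_le_of_le_ofReal zero_le_one ?_
    rw [ENNReal.ofReal_one, ← volume_Icc_zero_one (d := d)]
    exact measure_mono (box_subset_Icc hz)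
  have hcard : (Set.ncard {i | z.1 i ∈ box d z.2} : ℝ) / N ≤ 1 := by
    refine div_le_one_of_le₀ ?_ (Nat.cast_nonneg N)
    have := Set.ncard_le_card {i | z.1 i ∈ box d z.2}
    rw [Nat.card_fin] at this
    exact_mod_cast this
  have hcard0 : 0 ≤ (Set.ncard {i | z.1 i ∈ box d z.2} : ℝ) / N := by positivity
  rw [Real.norm_of_nonneg (Real.rpow_nonneg (abs_nonneg _) p)]
  refine Real.rpow_le_one (abs_nonneg _) (abs_le.2 ⟨?_, ?_⟩) hp <;>
    linarith [ENNReal.toReal_nonneg (a := volume (box d z.2))]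

/-- The mean of the `p`-th power of the local discrepancy at `x` of independent random points. -/
noncomputable def meanLocalDiscP (d N : ℕ) (p : ℝ) (ν : Fin N → Measure (Fin d → ℝ))
    (x : Fin d → ℝ) : ℝ :=
  poissonBinomialMean Finset.univ (fun i => (ν i).real (box d x))
    fun k => |(k : ℝ) / N - (volume (box d x)).toReal| ^ p

theorem integrable_meanLocalDiscP (hp : 0 ≤ p) (ν : Fin N → Measure (Fin d → ℝ))
    [∀ i, IsProbabilityMeasure (ν i)] :
    Integrable (meanLocalDiscP d N p ν) (volume.restrict (Set.Icc (0 : Fin d → ℝ) 1)) := by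
  refine (integrable_local_discrepancy hp (Measure.pi ν)).integral_prod_right.congr
    (Filter.Eventually.of_forall fun x => ?_)
  exact integral_pi_ncard ν (measurableSet_box x) fun k =>
    |(k : ℝ) / N - (volume (box d x)).toReal| ^ p

theorem integral_discP (hp : 0 ≤ p) (ν : Fin N → Measure (Fin d → ℝ))
    [∀ i, IsProbabilityMeasure (ν i)] :
    ∫ P, discP d N p P ∂(Measure.pi ν) =
      ∫ x in Set.Icc (0 : Fin d → ℝ) 1, meanLocalDiscP d N p ν x := by
  unfold discP
  rw [integral_integral_swap (integrable_local_discrepancy hp (Measure.pi ν))]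
  refine integral_congr_ae (Filter.Eventually.of_forall fun x => ?_)
  exact integral_pi_ncard ν (measurableSet_box x) fun k =>
    |(k : ℝ) / N - (volume (box d x)).toReal| ^ p

theorem meanLocalDiscP_lt (hN : 0 < N) (hp : 1 < p) (ν : Fin N → Measure (Fin d → ℝ))
    [∀ i, IsProbabilityMeasure (ν i)] (μ : Measure (Fin d → ℝ)) {x : Fin d → ℝ}
    (hsum : ∑ i, (ν i).real (box d x) = ∑ _i : Fin N, μ.real (box d x))
    (hne : ∃ i, (ν i).real (box d x) ≠ μ.real (box d x)) :
    meanLocalDiscP d N p ν x < meanLocalDiscP d N p (fun _ => μ) x := by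
  refine poissonBinomialMean_lt_binomial (fun i => measureReal_nonneg)
    (fun i => measureReal_le_one) (fun k => ?_) hsum hne
  have h := abs_rpow_second_difference_pos hp ((k : ℝ) / N - (volume (box d x)).toReal)
    (h := 1 / (N : ℝ)) (by positivity)
  have h1 : (k : ℝ) / N - (volume (box d x)).toReal + 1 / N =
      (k + 1 : ℕ) / N - (volume (box d x)).toReal := by push_cast; ring
  have h2 : (k : ℝ) / N - (volume (box d x)).toReal + 2 * (1 / N) =
      (k + 2 : ℕ) / N - (volume (box d x)).toReal := by push_cast; ring
  rwa [h1, h2] at h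

end Discrepancy

theorem unif_apply {d : ℕ} (A : Set (Fin d → ℝ)) {S : Set (Fin d → ℝ)} (hS : MeasurableSet S) :
    unif A S = (volume A)⁻¹ * volume (S ∩ A) := by
  rw [unif, Measure.smul_apply, smul_eq_mul, Measure.restrict_apply hS]

theorem isProbabilityMeasure_unif {d : ℕ} {A : Set (Fin d → ℝ)} (h0 : volume A ≠ 0)
    (htop : volume A ≠ ∞) : IsProbabilityMeasure (unif A) :=
  ⟨by rw [unif_apply A MeasurableSet.univ, Set.univ_inter, ENNReal.inv_mul_cancel h0 htop]⟩

theorem unif_absolutelyContinuous {d : ℕ} (A : Set (Fin d → ℝ)) : unif A ≪ volume.restrict A :=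
  Measure.smul_absolutelyContinuous

/-- Strong Partition Principle: for any equivolume measurable partition of `[0,1]^d`
with `N ≥ 2` sets and any `p > 1`, the stratified sample has strictly smaller mean
`L_p`-discrepancy (to the `p`-th power) than `N` i.i.d. uniform random points. -/
theorem stmt9 (d N : ℕ) (hN : 2 ≤ N) (p : ℝ) (hp : 1 < p)
    (Ω : Fin N → Set (Fin d → ℝ))
    (hmeas : ∀ i, MeasurableSet (Ω i))
    (hcover : (⋃ i, Ω i) = Set.Icc (0 : Fin d → ℝ) 1)
    (hdisj : ∀ i j, i ≠ j → volume (Ω i ∩ Ω j) = 0)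
    (hequi : ∀ i, volume (Ω i) = 1 / (N : ℝ≥0∞)) :
    (∫ P, discP d N p P ∂(Measure.pi fun i => unif (Ω i)))
      < (∫ P, discP d N p P
          ∂(Measure.pi fun _ : Fin N => volume.restrict (Set.Icc (0 : Fin d → ℝ) 1))) := by
  have hp0 : 0 ≤ p := by linarith
  have hNe : (N : ℝ≥0∞) ≠ 0 := by
    rw [Nat.cast_ne_zero]
    omega
  have hprob : ∀ i, IsProbabilityMeasure (unif (Ω i)) := fun i =>
    isProbabilityMeasure_unif (by simp [hequi]) (by simp [hequi, hNe])
  set μ : Measure (Fin d → ℝ) := volume.restrict (Set.Icc (0 : Fin d → ℝ) 1) with hμ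
  have hsub : ∀ i, Ω i ⊆ Set.Icc 0 1 := fun i => hcover ▸ Set.subset_iUnion Ω i
  have hsum : ∀ S, MeasurableSet S →
      ∑ i, (unif (Ω i)).real S = ∑ _i : Fin N, μ.real S := by
    intro S hS
    have hμsum : μ = Measure.sum fun i => volume.restrict (Ω i) := by
      rw [hμ, ← hcover]
      exact Measure.restrict_iUnion_ae (fun i j hij => hdisj i j hij)
        fun i => (hmeas i).nullMeasurableSet
    have hS' : ∑ i, unif (Ω i) S = ∑ _i : Fin N, μ S := by
      rw [hμsum, Measure.sum_apply _ hS, tsum_fintype, Finset.sum_const, Finset.card_univ,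
        Fintype.card_fin, nsmul_eq_mul, Finset.mul_sum]
      refine Finset.sum_congr rfl fun i _ => ?_
      rw [unif_apply _ hS, hequi, Measure.restrict_apply hS, one_div, inv_inv]
    have := congrArg ENNReal.toReal hS'
    rwa [ENNReal.toReal_sum fun i _ => measure_ne_top _ _,
      ENNReal.toReal_sum fun i _ => measure_ne_top _ _] at this
  rw [integral_discP hp0, integral_discP hp0]
  have hint := integrable_meanLocalDiscP (p := p) hp0 fun i => unif (Ω i)
  have hint' := integrable_meanLocalDiscP (p := p) hp0 fun _ : Fin N => μ
  have hcases : ∀ x, (∀ i, (unif (Ω i)).real (box d x) = μ.real (box d x)) ∨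
      meanLocalDiscP d N p (fun i => unif (Ω i)) x < meanLocalDiscP d N p (fun _ => μ) x := by
    intro x
    refine or_iff_not_imp_left.2 fun h => ?_
    exact meanLocalDiscP_lt (by omega) hp _ μ (hsum _ (measurableSet_box x)) (not_forall.1 h)
  have hle : ∀ x, meanLocalDiscP d N p (fun i => unif (Ω i)) x ≤
      meanLocalDiscP d N p (fun _ => μ) x := fun x => by
    rcases hcases x with h | h
    · simp only [meanLocalDiscP, h, le_refl]
    · exact h.le
  refine (integral_mono hint hint' hle).lt_of_ne fun heq => ?_
  have hae := (integral_eq_iff_of_ae_le hint hint' (Filter.Eventually.of_forall hle)).1 heq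
  let i : Fin N := ⟨0, by omega⟩
  have hunif : unif (Ω i) = μ := by
    refine eq_restrict_Icc_of_ae_measure_box_eq
      ((unif_absolutelyContinuous _).trans Measure.restrict_le_self.absolutelyContinuous)
      ((unif_absolutelyContinuous _).ae_le ?_) ?_
    · filter_upwards [ae_restrict_mem (hmeas i)] with z hz using hsub i hz
    · filter_upwards [hae, ae_restrict_mem measurableSet_Icc] with x hx hxI
      have := ((hcases x).resolve_right hx.not_lt) i
      rw [measureReal_def, measureReal_def,
        ENNReal.toReal_eq_toReal_iff' (measure_ne_top _ _) (measure_ne_top _ _)] at this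
      rw [this, hμ, Measure.restrict_eq_self _ (box_subset_Icc hxI)]
  have hvol : (1 : ℝ≥0∞) = 1 / N := by
    calc (1 : ℝ≥0∞) = unif (Ω i) (Ω i) := by
          rw [unif_apply _ (hmeas i), Set.inter_self, hequi,
            ENNReal.inv_mul_cancel (by simp) (by simp [hNe])]
      _ = 1 / N := by rw [hunif, hμ, Measure.restrict_eq_self _ (hsub i), hequi]
  rw [one_div, eq_comm, ENNReal.inv_eq_one] at hvol
  have : N = 1 := by exact_mod_cast hvol
  omega
end

section
/- Let d = 1 and N = 2. An equivolume measurable partition (Ω_1, Ω_2) of [0,1] (both sets of Lebesgue measure 1/2) minimizes the expected squared L2-discrepancy of its stratified sample among all such partitions if and only if Ω_1 coincides up to a Lebesgue-null set with [0,1/2] or with [1/2,1]; the minimal value of E L2(P_Ω)^2 is 1/24. -/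
open MeasureTheory Set
open scoped ENNReal

/-- The squared `L2`-discrepancy of a two-point set `P` in `[0,1]`. -/
noncomputable def disc2one (P : Fin 2 → ℝ) : ℝ :=
  ∫ x in Set.Icc (0 : ℝ) 1, ((Set.ncard {i | P i ∈ Set.Ico (0 : ℝ) x} : ℝ) / 2 - x) ^ 2

/-- The uniform probability measure on a set `Ω ⊆ ℝ` (normalized Lebesgue measure). -/
noncomputable def unif1 (Ω : Set ℝ) : Measure ℝ :=
  (volume Ω)⁻¹ • volume.restrict Ω

/-- The mean squared `L2`-discrepancy of the stratified sample based on `(Ω 0, Ω 1)`. -/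
noncomputable def meanDisc (Ω : Fin 2 → Set ℝ) : ℝ :=
  ∫ P, disc2one P ∂(Measure.pi fun i => unif1 (Ω i))

/-- A two-set equivolume measurable partition of `[0,1]`. -/
def IsEquiPart (Ω : Fin 2 → Set ℝ) : Prop :=
  (∀ i, MeasurableSet (Ω i)) ∧ (⋃ i, Ω i) = Set.Icc (0 : ℝ) 1 ∧
    volume (Ω 0 ∩ Ω 1) = 0 ∧ (∀ i, volume (Ω i) = 1 / 2)

/-- The distribution function of the uniform distribution on a set of measure `1 / 2`. -/
noncomputable def halfCdf (A : Set ℝ) (x : ℝ) : ℝ := 2 * volume.real (A ∩ Ico 0 x)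

lemma ncard_fin_two_eq_sum_indicator (P : Fin 2 → ℝ) (s : Set ℝ) :
    (Set.ncard {i | P i ∈ s} : ℝ) = s.indicator 1 (P 0) + s.indicator 1 (P 1) := by
  classical
  have h : {i | P i ∈ s} =
      ((Finset.univ.filter fun i => P i ∈ s : Finset (Fin 2)) : Set (Fin 2)) := by
    ext; simp
  rw [h, Set.ncard_coe_finset, Finset.card_filter, Fin.sum_univ_two]
  simp [Set.indicator_apply]

lemma isProbabilityMeasure_unif1 {A : Set ℝ} (hA : volume A = 1 / 2) :
    IsProbabilityMeasure (unif1 A) := by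
  refine ⟨?_⟩
  rw [unif1, Measure.smul_apply, Measure.restrict_apply_univ, smul_eq_mul, hA]
  exact ENNReal.inv_mul_cancel (by simp) (by simp)

lemma integral_indicator_Ico_unif1 {A : Set ℝ} (hA : volume A = 1 / 2) (x : ℝ) :
    ∫ y, (Ico 0 x).indicator (1 : ℝ → ℝ) y ∂unif1 A = halfCdf A x := by
  rw [integral_indicator_one measurableSet_Ico, unif1, measureReal_ennreal_smul_apply,
    measureReal_restrict_apply measurableSet_Ico, hA, halfCdf, inter_comm]
  simp

lemma integral_pi_unif1 {Ω : Fin 2 → Set ℝ} (hΩ : ∀ i, volume (Ω i) = 1 / 2) (x : ℝ) :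
    ∫ P : Fin 2 → ℝ, ((Set.ncard {i | P i ∈ Ico (0 : ℝ) x} : ℝ) / 2 - x) ^ 2
        ∂(Measure.pi fun i => unif1 (Ω i)) =
      (halfCdf (Ω 0) x + halfCdf (Ω 1) x + 2 * (halfCdf (Ω 0) x * halfCdf (Ω 1) x)) / 4
        - x * (halfCdf (Ω 0) x + halfCdf (Ω 1) x) + x ^ 2 := by
  have hprob : ∀ i, IsProbabilityMeasure (unif1 (Ω i)) := fun i =>
    isProbabilityMeasure_unif1 (hΩ i)
  set μ := Measure.pi fun i => unif1 (Ω i)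
  set a : ℝ → ℝ := (Ico 0 x).indicator 1 with ha
  have ham : Measurable a := measurable_one.indicator measurableSet_Ico
  have ha01 : ∀ y, a y = 0 ∨ a y = 1 := fun y => by
    by_cases h : y ∈ Ico 0 x <;> simp [ha, h]
  have hprod : ∫ P : Fin 2 → ℝ, a (P 0) * a (P 1) ∂μ = halfCdf (Ω 0) x * halfCdf (Ω 1) x := by
    have h := integral_fintype_prod_eq_prod (fun _ : Fin 2 => a) (μ := fun i => unif1 (Ω i))
    simpa only [Fin.prod_univ_two, ha, integral_indicator_Ico_unif1 (hΩ _)] using h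
  have hcoord : ∀ i, ∫ P : Fin 2 → ℝ, a (P i) ∂μ = halfCdf (Ω i) x := fun i => by
    rw [← integral_indicator_Ico_unif1 (hΩ i)]
    exact integral_comp_eval (μ := fun i => unif1 (Ω i)) ham.aestronglyMeasurable
  have hint : ∀ i, Integrable (fun P : Fin 2 → ℝ => a (P i)) μ := fun i =>
    .of_bound (ham.comp (measurable_pi_apply i)).aestronglyMeasurable 1 (.of_forall fun P => by
      rcases ha01 (P i) with h | h <;> simp [h])
  have hint₂ : Integrable (fun P : Fin 2 → ℝ => a (P 0) * a (P 1)) μ :=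
    .of_bound
      ((hint 0).aestronglyMeasurable.mul (hint 1).aestronglyMeasurable) 1 (.of_forall fun P => by
      rcases ha01 (P 0) with h | h <;> rcases ha01 (P 1) with h' | h' <;> simp [h, h'])
  have hexp : ∀ P : Fin 2 → ℝ, ((Set.ncard {i | P i ∈ Ico (0 : ℝ) x} : ℝ) / 2 - x) ^ 2 =
      (1 / 4 - x) * a (P 0) + (1 / 4 - x) * a (P 1) + 1 / 2 * (a (P 0) * a (P 1)) + x ^ 2 := by
    intro P
    rw [ncard_fin_two_eq_sum_indicator]
    change ((a (P 0) + a (P 1)) / 2 - x) ^ 2 = _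
    rcases ha01 (P 0) with h | h <;> rcases ha01 (P 1) with h' | h' <;> rw [h, h'] <;> ring
  simp_rw [hexp]
  have hlin : Integrable (fun P : Fin 2 → ℝ => (1 / 4 - x) * a (P 0) + (1 / 4 - x) * a (P 1)) μ :=
    ((hint 0).const_mul _).add ((hint 1).const_mul _)
  have hquad : Integrable (fun P : Fin 2 → ℝ =>
      (1 / 4 - x) * a (P 0) + (1 / 4 - x) * a (P 1) + 1 / 2 * (a (P 0) * a (P 1))) μ :=
    hlin.add (hint₂.const_mul _)
  rw [integral_add hquad (integrable_const _), integral_add hlin (hint₂.const_mul _),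
    integral_add ((hint 0).const_mul _) ((hint 1).const_mul _), integral_const_mul,
    integral_const_mul, integral_const_mul, hcoord, hcoord, hprod]
  simp
  ring

lemma monotone_halfCdf {A : Set ℝ} (hA : volume A = 1 / 2) : Monotone (halfCdf A) := by
  intro x y hxy
  have hfin : volume (A ∩ Ico 0 y) ≠ ∞ := measure_ne_top_of_subset inter_subset_left (by simp [hA])
  have := measureReal_mono
    (show A ∩ Ico 0 x ⊆ A ∩ Ico 0 y from inter_subset_inter_right A (Ico_subset_Ico_right hxy)) hfin
  unfold halfCdf
  linarith

lemma halfCdf_nonneg (A : Set ℝ) (x : ℝ) : 0 ≤ halfCdf A x := by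
  unfold halfCdf; positivity

lemma halfCdf_le_one {A : Set ℝ} (hA : volume A = 1 / 2) (x : ℝ) : halfCdf A x ≤ 1 := by
  have := measureReal_mono (μ := volume) (inter_subset_left (s := A) (t := Ico 0 x)) (by simp [hA])
  have h : volume.real A = 1 / 2 := by simp [measureReal_def, hA]
  unfold halfCdf
  linarith

lemma IsEquiPart.halfCdf_add {Ω : Fin 2 → Set ℝ} (hΩ : IsEquiPart Ω) {x : ℝ}
    (hx : x ∈ Icc (0 : ℝ) 1) : halfCdf (Ω 0) x + halfCdf (Ω 1) x = 2 * x := by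
  obtain ⟨hm, hU, hI, hv⟩ := hΩ
  have hfin : ∀ i, volume (Ω i ∩ Ico 0 x) ≠ ∞ := fun i =>
    measure_ne_top_of_subset inter_subset_left (by simp [hv])
  have h := measureReal_union_add_inter (μ := volume) (s := Ω 0 ∩ Ico 0 x)
    ((hm 1).inter measurableSet_Ico) (hfin 0) (hfin 1)
  have hU' : Ω 0 ∪ Ω 1 = Icc 0 1 := by
    rw [← hU]; ext y; simp [Fin.exists_fin_two]
  have h1 : Ω 0 ∩ Ico 0 x ∪ Ω 1 ∩ Ico 0 x = Ico 0 x := by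
    rw [← union_inter_distrib_right, hU', inter_eq_right]
    exact Ico_subset_Icc_self.trans (Icc_subset_Icc_right hx.2)
  have h2 : volume.real (Ω 0 ∩ Ico 0 x ∩ (Ω 1 ∩ Ico 0 x)) = 0 := by
    rw [measureReal_def, measure_mono_null _ hI, ENNReal.toReal_zero]
    exact inter_subset_inter inter_subset_left inter_subset_left
  rw [h1, h2, Real.volume_real_Ico_of_le hx.1] at h
  unfold halfCdf
  linarith

lemma IsEquiPart.continuousOn_halfCdf {Ω : Fin 2 → Set ℝ} (hΩ : IsEquiPart Ω) :
    ContinuousOn (halfCdf (Ω 0)) (Icc 0 1) := by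
  refine (LipschitzOnWith.of_le_add_mul 2 fun x hx y hy => ?_).continuousOn
  have hx' := hΩ.halfCdf_add hx
  have hy' := hΩ.halfCdf_add hy
  rw [Real.dist_eq, NNReal.coe_ofNat]
  rcases le_total x y with h | h
  · have := monotone_halfCdf (hΩ.2.2.2 0) h
    have := abs_nonneg (x - y)
    linarith
  · have := monotone_halfCdf (hΩ.2.2.2 1) h
    have := le_abs_self (x - y)
    linarith

lemma IsEquiPart.meanDisc_eq {Ω : Fin 2 → Set ℝ} (hΩ : IsEquiPart Ω) :
    meanDisc Ω = ∫ x in (0 : ℝ)..1,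
      (x / 2 - x ^ 2 + halfCdf (Ω 0) x * (2 * x - halfCdf (Ω 0) x) / 2) := by
  have hprob : ∀ i, IsProbabilityMeasure (unif1 (Ω i)) := fun i =>
    isProbabilityMeasure_unif1 (hΩ.2.2.2 i)
  unfold meanDisc disc2one
  rw [integral_integral_swap, intervalIntegral.integral_of_le zero_le_one,
    ← integral_Icc_eq_integral_Ioc]
  · refine setIntegral_congr_fun measurableSet_Icc fun x hx => ?_
    have h := hΩ.halfCdf_add hx
    have h1 : halfCdf (Ω 1) x = 2 * x - halfCdf (Ω 0) x := by linarith
    simp only [integral_pi_unif1 hΩ.2.2.2, h1]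
    ring
  · have hmeas : ∀ i, MeasurableSet {p : (Fin 2 → ℝ) × ℝ | p.1 i ∈ Ico 0 p.2} := fun i => by
      have hi : Measurable fun p : (Fin 2 → ℝ) × ℝ => p.1 i := by fun_prop
      exact (measurableSet_le measurable_const hi).inter (measurableSet_lt hi measurable_snd)
    have hind : ∀ i, Measurable fun p : (Fin 2 → ℝ) × ℝ =>
        (Ico 0 p.2).indicator (1 : ℝ → ℝ) (p.1 i) := fun i =>
      (measurable_one (α := ℝ)).indicator (hmeas i)
    refine .of_bound (C := 1) ?_ ?_
    · simp only [ncard_fin_two_eq_sum_indicator, Function.uncurry_def]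
      have := hind 0
      have := hind 1
      fun_prop
    · have hx : ∀ᵐ p ∂(Measure.pi fun i => unif1 (Ω i)).prod (volume.restrict (Icc (0 : ℝ) 1)),
          p.2 ∈ Icc (0 : ℝ) 1 :=
        Measure.quasiMeasurePreserving_snd.ae (ae_restrict_mem measurableSet_Icc)
      filter_upwards [hx] with p hp
      have hc : ((Set.ncard {i | p.1 i ∈ Ico 0 p.2} : ℕ) : ℝ) ≤ 2 := by
        have := Set.ncard_le_card {i | p.1 i ∈ Ico 0 p.2}
        exact_mod_cast this.trans_eq (by simp)
      have hc0 : (0 : ℝ) ≤ (Set.ncard {i | p.1 i ∈ Ico 0 p.2} : ℕ) := by positivity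
      obtain ⟨h0, h1⟩ := hp
      rw [Function.uncurry_def, Real.norm_eq_abs, abs_of_nonneg (sq_nonneg _),
        sq_le_one_iff_abs_le_one,
        abs_le]
      constructor <;> linarith

/-- The pointwise minimum of the integrand of the mean discrepancy. -/
noncomputable def discFloor (x : ℝ) : ℝ := x / 2 - x ^ 2 + max 0 (2 * x - 1) / 2

lemma continuous_discFloor : Continuous discFloor := by
  unfold discFloor; fun_prop

lemma integral_discFloor : ∫ x in (0 : ℝ)..1, discFloor x = 1 / 24 := by
  have hi : ∀ a b, IntervalIntegrable discFloor volume a b := fun a b =>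
    continuous_discFloor.intervalIntegrable a b
  rw [← intervalIntegral.integral_add_adjacent_intervals (hi 0 (1 / 2)) (hi (1 / 2) 1)]
  have h1 : ∫ x in (0 : ℝ)..1 / 2, discFloor x = ∫ x in (0 : ℝ)..1 / 2, (x / 2 - x ^ 2) := by
    refine intervalIntegral.integral_congr fun x hx => ?_
    rw [uIcc_of_le (by norm_num)] at hx
    simp only [discFloor]
    rw [max_eq_left (by linarith [hx.2])]
    ring
  have h2 : ∫ x in (1 / 2 : ℝ)..1, discFloor x =
      ∫ x in (1 / 2 : ℝ)..1, (3 / 2 * x - x ^ 2 - 1 / 2) := by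
    refine intervalIntegral.integral_congr fun x hx => ?_
    rw [uIcc_of_le (by norm_num)] at hx
    simp only [discFloor]
    rw [max_eq_right (by linarith [hx.1])]
    ring
  rw [h1, h2, intervalIntegral.integral_sub, intervalIntegral.integral_sub,
    intervalIntegral.integral_sub, intervalIntegral.integral_const_mul,
    intervalIntegral.integral_div, integral_id, integral_id, integral_pow, integral_pow,
    intervalIntegral.integral_const]
  · norm_num
  all_goals exact Continuous.intervalIntegrable (by fun_prop) _ _

lemma IsEquiPart.discFloor_le {Ω : Fin 2 → Set ℝ} (hΩ : IsEquiPart Ω) {x : ℝ}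
    (hx : x ∈ Icc (0 : ℝ) 1) :
    discFloor x ≤ x / 2 - x ^ 2 + halfCdf (Ω 0) x * (2 * x - halfCdf (Ω 0) x) / 2 := by
  have h := hΩ.halfCdf_add hx
  have h1 : halfCdf (Ω 1) x = 2 * x - halfCdf (Ω 0) x := by linarith
  have h0 := mul_nonneg (halfCdf_nonneg (Ω 0) x) (halfCdf_nonneg (Ω 1) x)
  have h2 := mul_nonneg (sub_nonneg.2 (halfCdf_le_one (hΩ.2.2.2 0) x))
    (sub_nonneg.2 (halfCdf_le_one (hΩ.2.2.2 1) x))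
  rw [h1] at h0 h2
  have : max 0 (2 * x - 1) ≤ halfCdf (Ω 0) x * (2 * x - halfCdf (Ω 0) x) :=
    max_le h0 (by linarith)
  unfold discFloor
  linarith

lemma IsEquiPart.continuousOn_integrand {Ω : Fin 2 → Set ℝ} (hΩ : IsEquiPart Ω) :
    ContinuousOn (fun x => x / 2 - x ^ 2 + halfCdf (Ω 0) x * (2 * x - halfCdf (Ω 0) x) / 2)
      (Icc 0 1) := by
  have := hΩ.continuousOn_halfCdf
  fun_prop

lemma IsEquiPart.le_meanDisc {Ω : Fin 2 → Set ℝ} (hΩ : IsEquiPart Ω) : 1 / 24 ≤ meanDisc Ω := by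
  rw [hΩ.meanDisc_eq, ← integral_discFloor]
  refine intervalIntegral.integral_mono_on zero_le_one
    (continuous_discFloor.intervalIntegrable _ _) ?_ fun x hx => hΩ.discFloor_le hx
  exact ContinuousOn.intervalIntegrable_of_Icc zero_le_one hΩ.continuousOn_integrand

lemma IsEquiPart.meanDisc_eq_iff {Ω : Fin 2 → Set ℝ} (hΩ : IsEquiPart Ω) :
    meanDisc Ω = 1 / 24 ↔ halfCdf (Ω 0) (1 / 2) = 1 ∨ halfCdf (Ω 0) (1 / 2) = 0 := by
  have hhalf : (1 / 2 : ℝ) ∈ Icc (0 : ℝ) 1 := by constructor <;> norm_num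
  constructor
  · intro h
    by_contra! hne
    refine h.not_gt ?_
    rw [hΩ.meanDisc_eq, ← integral_discFloor]
    refine intervalIntegral.integral_lt_integral_of_continuousOn_of_le_of_exists_lt zero_lt_one
      continuous_discFloor.continuousOn hΩ.continuousOn_integrand
      (fun x hx => hΩ.discFloor_le (Ioc_subset_Icc_self hx)) ⟨1 / 2, hhalf, ?_⟩
    have h0 := (halfCdf_nonneg (Ω 0) (1 / 2)).lt_of_ne' hne.2
    have h1 := (halfCdf_le_one (hΩ.2.2.2 0) (1 / 2)).lt_of_ne hne.1
    have := mul_pos h0 (sub_pos.2 h1)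
    simp only [discFloor]
    norm_num at this ⊢
    linarith
  · intro h
    rw [hΩ.meanDisc_eq, ← integral_discFloor]
    refine intervalIntegral.integral_congr fun x hx => ?_
    rw [uIcc_of_le zero_le_one] at hx
    have hsum := hΩ.halfCdf_add hx
    have hsum' := hΩ.halfCdf_add hhalf
    have n0 := halfCdf_nonneg (Ω 0) x
    have n1 := halfCdf_nonneg (Ω 1) x
    have l0 := halfCdf_le_one (hΩ.2.2.2 0) x
    have l1 := halfCdf_le_one (hΩ.2.2.2 1) x
    simp only [discFloor]
    rcases le_total x (1 / 2) with hle | hle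
    · have m0 := monotone_halfCdf (hΩ.2.2.2 0) hle
      have m1 := monotone_halfCdf (hΩ.2.2.2 1) hle
      rw [max_eq_left (by linarith)]
      rcases h with h | h
      · rw [show halfCdf (Ω 0) x = 2 * x by linarith]; ring
      · rw [show halfCdf (Ω 0) x = 0 by linarith]; ring
    · have m0 := monotone_halfCdf (hΩ.2.2.2 0) hle
      have m1 := monotone_halfCdf (hΩ.2.2.2 1) hle
      rw [max_eq_right (by linarith)]
      rcases h with h | h
      · rw [show halfCdf (Ω 0) x = 1 by linarith]; ring
      · rw [show halfCdf (Ω 0) x = 2 * x - 1 by linarith]; ring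

lemma halfCdf_half_congr {A B : Set ℝ} (h : volume (symmDiff A B) = 0) :
    halfCdf A (1 / 2) = halfCdf B (1 / 2) := by
  have h' := measure_symmDiff_eq_zero_iff.1 h
  unfold halfCdf
  rw [measureReal_congr (h'.inter (Filter.EventuallyEq.refl _ (Ico 0 (1 / 2))))]

lemma halfCdf_half_eq_one_iff {A : Set ℝ} (hA : MeasurableSet A) (hv : volume A = 1 / 2) :
    halfCdf A (1 / 2) = 1 ↔ volume (symmDiff A (Icc (0 : ℝ) (1 / 2))) = 0 := by
  constructor
  · intro h
    have hr : volume.real (A ∩ Ico 0 (1 / 2)) = 1 / 2 := by unfold halfCdf at h; linarith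
    have hfin : volume (A ∩ Ico 0 (1 / 2)) ≠ ∞ :=
      measure_ne_top_of_subset inter_subset_left (by simp [hv])
    have hm : volume (A ∩ Ico 0 (1 / 2)) = 1 / 2 := by
      rw [← ENNReal.ofReal_toReal hfin, ← measureReal_def, hr, ENNReal.ofReal_div_of_pos two_pos]
      simp
    have hm' := (hA.inter (measurableSet_Ico (a := (0 : ℝ)) (b := 1 / 2))).nullMeasurableSet
      (μ := volume)
    have e1 : (A ∩ Ico 0 (1 / 2) : Set ℝ) =ᵐ[volume] A :=
      ae_eq_of_subset_of_measure_ge inter_subset_left (by rw [hm, hv]) hm' (by simp [hv])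
    have e2 : (A ∩ Ico 0 (1 / 2) : Set ℝ) =ᵐ[volume] Icc (0 : ℝ) (1 / 2) := by
      refine ae_eq_of_subset_of_measure_ge (inter_subset_right.trans Ico_subset_Icc_self) ?_ hm'
        (by simp)
      rw [hm, Real.volume_Icc, sub_zero, ENNReal.ofReal_div_of_pos two_pos]
      simp
    exact measure_symmDiff_eq_zero_iff.2 (e1.symm.trans e2)
  · intro h
    rw [halfCdf_half_congr h, halfCdf, inter_eq_right.2 Ico_subset_Icc_self,
      Real.volume_real_Ico_of_le (by norm_num)]
    norm_num

lemma halfCdf_half_eq_zero_iff {A : Set ℝ} (hA : MeasurableSet A) (hv : volume A = 1 / 2)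
    (hsub : A ⊆ Icc 0 1) :
    halfCdf A (1 / 2) = 0 ↔ volume (symmDiff A (Icc (1 / 2 : ℝ) 1)) = 0 := by
  constructor
  · intro h
    have hr : volume.real (A ∩ Ico 0 (1 / 2)) = 0 := by unfold halfCdf at h; linarith
    have hfin : volume (A ∩ Ico 0 (1 / 2)) ≠ ∞ :=
      measure_ne_top_of_subset inter_subset_left (by simp [hv])
    have hm : volume (A ∩ Ico 0 (1 / 2)) = 0 := (measureReal_eq_zero_iff hfin).1 hr
    have hdiff : A \ Icc (1 / 2) 1 ⊆ A ∩ Ico 0 (1 / 2) := fun y hy =>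
      ⟨hy.1, (hsub hy.1).1, not_le.1 fun hle => hy.2 ⟨hle, (hsub hy.1).2⟩⟩
    have hle : (A : Set ℝ) ≤ᵐ[volume] Icc (1 / 2 : ℝ) 1 :=
      ae_le_set.2 (measure_mono_null hdiff hm)
    refine measure_symmDiff_eq_zero_iff.2
      (ae_eq_of_ae_subset_of_measure_ge hle ?_ hA.nullMeasurableSet (by simp))
    rw [hv, Real.volume_Icc, show (1 - 1 / 2 : ℝ) = 1 / 2 by norm_num,
      ENNReal.ofReal_div_of_pos two_pos]
    simp
  · intro h
    have he : Icc (1 / 2 : ℝ) 1 ∩ Ico 0 (1 / 2) = ∅ := by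
      ext y
      simp only [mem_inter_iff, mem_Icc, mem_Ico, mem_empty_iff_false, iff_false]
      rintro ⟨⟨h1, -⟩, -, h2⟩
      exact h2.not_ge h1
    rw [halfCdf_half_congr h, halfCdf, he]
    simp

lemma IsEquiPart.meanDisc_eq_iff_volume_symmDiff {Ω : Fin 2 → Set ℝ} (hΩ : IsEquiPart Ω) :
    meanDisc Ω = 1 / 24 ↔ (volume (symmDiff (Ω 0) (Set.Icc (0 : ℝ) (1 / 2))) = 0
      ∨ volume (symmDiff (Ω 0) (Set.Icc (1 / 2 : ℝ) 1)) = 0) := by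
  rw [hΩ.meanDisc_eq_iff, halfCdf_half_eq_one_iff (hΩ.1 0) (hΩ.2.2.2 0),
    halfCdf_half_eq_zero_iff (hΩ.1 0) (hΩ.2.2.2 0) (hΩ.2.1 ▸ subset_iUnion Ω 0)]

lemma isEquiPart_halves : IsEquiPart ![Icc (0 : ℝ) (1 / 2), Icc (1 / 2 : ℝ) 1] := by
  have hhalf : ENNReal.ofReal (1 / 2) = 1 / 2 := by
    rw [ENNReal.ofReal_div_of_pos two_pos]; simp
  refine ⟨fun i => ?_, ?_, ?_, fun i => ?_⟩
  · fin_cases i <;> exact measurableSet_Icc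
  · rw [← Icc_union_Icc_eq_Icc (show (0 : ℝ) ≤ 1 / 2 by norm_num)
      (show (1 / 2 : ℝ) ≤ 1 by norm_num)]
    ext y
    simp [Fin.exists_fin_two]
  · change volume (Icc (0 : ℝ) (1 / 2) ∩ Icc (1 / 2) 1) = 0
    rw [Icc_inter_Icc_eq_singleton (by norm_num) (by norm_num)]
    simp
  · fin_cases i
    · change volume (Icc (0 : ℝ) (1 / 2)) = 1 / 2
      rw [Real.volume_Icc, sub_zero, hhalf]
    · change volume (Icc (1 / 2 : ℝ) 1) = 1 / 2
      rw [Real.volume_Icc, show (1 - 1 / 2 : ℝ) = 1 / 2 by norm_num, hhalf]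

/-- For `d = 1`, `N = 2`: an equivolume measurable partition `(Ω_1, Ω_2)` of `[0,1]`
minimizes the expected squared `L2`-discrepancy of its stratified sample among all
such partitions iff `Ω_1` coincides up to a null set with `[0,1/2]` or `[1/2,1]`;
the minimal value is `1/24`. -/
theorem stmt10 (Ω : Fin 2 → Set ℝ) (hΩ : IsEquiPart Ω) :
    ((∀ Ω', IsEquiPart Ω' → meanDisc Ω ≤ meanDisc Ω')
        ↔ (volume (symmDiff (Ω 0) (Set.Icc (0 : ℝ) (1 / 2))) = 0
            ∨ volume (symmDiff (Ω 0) (Set.Icc (1 / 2 : ℝ) 1)) = 0))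
    ∧ ((volume (symmDiff (Ω 0) (Set.Icc (0 : ℝ) (1 / 2))) = 0
            ∨ volume (symmDiff (Ω 0) (Set.Icc (1 / 2 : ℝ) 1)) = 0)
        → meanDisc Ω = 1 / 24) := by
  rw [← hΩ.meanDisc_eq_iff_volume_symmDiff]
  refine ⟨⟨fun h => ?_, fun h Ω' hΩ' => h ▸ hΩ'.le_meanDisc⟩, id⟩
  refine ((h _ isEquiPart_halves).trans_eq ?_).antisymm hΩ.le_meanDisc
  exact isEquiPart_halves.meanDisc_eq_iff_volume_symmDiff.2 (Or.inl (by simp))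
end
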